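/- Let u(x,y) = -M y^β + ε|x|^{2-α}(1+y)^{-γ} on the upper half plane {y > 0}, with constants ε, M > 0 and 0 < α, β, γ < 1, and let F(u) = (y u_xx - u_y)(y u_yy - u_y) - y² u_xy². If γ < 1 - α, then F(u) > 0 at every point (x,y) with x ≠ 0, y > 0. -/

import Mathlib

noncomputable section
open Real Set

/-- The barrier support function `u(x,y) = -M y^β + ε|x|^{2-α}(1+y)^{-γ}`. -/
def uPow (M ε α β γ : ℝ) (x y : ℝ) : ℝ :=
  -M * y ^ β + ε * |x| ^ (2 - α) * (1 + y) ^ (-γ)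

theorem absd_aux (s p x : ℝ) (hs : s = 1 ∨ s = -1) (hx : 0 < s * x) :
    HasDerivAt (fun t : ℝ => |t| ^ p) (s * (p * |x| ^ (p - 1))) x := by
  have habs : ∀ t : ℝ, 0 < s * t → |t| = s * t := by
    intro t ht
    rcases hs with rfl | rfl
    · rw [one_mul] at *; exact abs_of_pos ht
    · rw [abs_of_neg (by linarith)]; ring
  have h1 : HasDerivAt (fun t : ℝ => s * t) s x := by
    simpa using (hasDerivAt_id x).const_mul s
  have h2 := h1.rpow_const (p := p) (Or.inl hx.ne')
  have hev : ∀ᶠ t in nhds x, 0 < s * t :=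
    (continuous_const.mul continuous_id).continuousAt.eventually (lt_mem_nhds hx)
  have h3 := h2.congr_of_eventuallyEq (f₁ := fun t : ℝ => |t| ^ p)
    (by filter_upwards [hev] with t ht; rw [habs t ht])
  have e : s * (p * |x| ^ (p - 1)) = s * p * (s * x) ^ (p - 1) := by
    rw [habs x hx]; ring
  rw [e]
  exact h3

theorem alg_aux (P Q K α β γ y w s : ℝ) (hP : 0 < P) (hQ : 0 < Q) (hK : 0 < K)
    (hs : s ^ 2 = 1) (hα0 : 0 < α) (hα1 : α < 1) (hβ1 : β < 1) (hγ0 : 0 < γ)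
    (hγα : γ < 1 - α) (hy : 0 < y) (hw : w = 1 + y) :
    0 < (y * ((2 - α) * (1 - α) * K) + (P + γ * Q ^ 2 * K / w))
        * (P * (1 - β) + γ * (1 + γ) * Q ^ 2 * K * y / w ^ 2 + (P + γ * Q ^ 2 * K / w))
      - y ^ 2 * (s * ((2 - α) * γ * Q * K / w)) ^ 2 := by
  have hw0 : 0 < w := by linarith
  have a1 : 0 < 1 - α := by linarith
  have a2 : 0 < 2 - α := by linarith
  have b1 : 0 < 1 - β := by linarith
  have key : 0 < (2 - α) * γ * y * K ^ 2 * Q ^ 2 / w ^ 2 *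
      ((1 - α) + y * (2 - 2 * α - γ)) := by
    have : 0 < 2 - 2 * α - γ := by linarith
    positivity
  have e : (y * ((2 - α) * (1 - α) * K) + (P + γ * Q ^ 2 * K / w))
        * (P * (1 - β) + γ * (1 + γ) * Q ^ 2 * K * y / w ^ 2 + (P + γ * Q ^ 2 * K / w))
      - y ^ 2 * (s * ((2 - α) * γ * Q * K / w)) ^ 2
      = (2 - α) * γ * y * K ^ 2 * Q ^ 2 / w ^ 2 * ((1 - α) + y * (2 - 2 * α - γ))
      + (y * ((2 - α) * (1 - α) * K) * (P * (1 - β) + P)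
        + (P + γ * Q ^ 2 * K / w) * (P * (1 - β) + γ * (1 + γ) * Q ^ 2 * K * y / w ^ 2
          + (P + γ * Q ^ 2 * K / w))) := by
    have : (s * ((2 - α) * γ * Q * K / w)) ^ 2 = ((2 - α) * γ * Q * K / w) ^ 2 := by
      rw [mul_pow, hs, one_mul]
    rw [this]
    have hw' : (1 + y) ≠ 0 := by linarith
    subst hw
    field_simp
    ring
  rw [e]
  positivity

/-- Let `u(x,y) = -M y^β + ε|x|^{2-α}(1+y)^{-γ}` with `ε, M > 0` and `0 < α, β, γ < 1`,
and let `F(u) = (y u_xx - u_y)(y u_yy - u_y) - y² u_xy²`. If `γ < 1 - α`, then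
`F(u) > 0` at every point with `x ≠ 0`, `y > 0`. -/
theorem stmt17 (M ε α β γ : ℝ) (hM : 0 < M) (hε : 0 < ε)
    (hα0 : 0 < α) (hα1 : α < 1) (hβ0 : 0 < β) (hβ1 : β < 1) (hγ0 : 0 < γ) (hγ1 : γ < 1)
    (hγα : γ < 1 - α) :
    ∀ x y : ℝ, x ≠ 0 → 0 < y →
      let u := uPow M ε α β γ
      let uy := deriv (fun y' => u x y') y
      let uxx := deriv (fun x' => deriv (fun x'' => u x'' y) x') x
      let uyy := deriv (fun y' => deriv (fun y'' => u x y'') y') y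
      let uxy := deriv (fun y' => deriv (fun x' => u x' y') x) y
      0 < (y * uxx - uy) * (y * uyy - uy) - y ^ 2 * uxy ^ 2 := by
  intro x y hx hy u uy uxx uyy uxy
  obtain ⟨s, hs, hsx⟩ : ∃ s : ℝ, (s = 1 ∨ s = -1) ∧ 0 < s * x := by
    rcases lt_or_gt_of_ne hx with h | h
    · exact ⟨-1, Or.inr rfl, by linarith⟩
    · exact ⟨1, Or.inl rfl, by linarith⟩
  have hX : 0 < |x| := abs_pos.mpr hx
  have hrp : ∀ p t : ℝ, 0 < t → HasDerivAt (fun y' : ℝ => y' ^ p) (p * t ^ (p - 1)) t :=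
    fun p t ht => Real.hasDerivAt_rpow_const (Or.inl ht.ne')
  have hrp1 : ∀ p t : ℝ, 0 < t →
      HasDerivAt (fun y' : ℝ => (1 + y') ^ p) (p * (1 + t) ^ (p - 1)) t := by
    intro p t ht
    have h1 : HasDerivAt (fun t : ℝ => 1 + t) 1 t := (hasDerivAt_id t).const_add 1
    have := h1.rpow_const (p := p) (Or.inl (by linarith))
    simpa using this
  have hevy : ∀ᶠ t in nhds y, 0 < t := lt_mem_nhds hy
  have hevx : ∀ᶠ t in nhds x, 0 < s * t :=
    (continuous_const.mul continuous_id).continuousAt.eventually (lt_mem_nhds hsx)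
  -- first derivatives
  have hy1 : ∀ t : ℝ, 0 < t → deriv (fun y' => u x y') t
      = -M * (β * t ^ (β - 1)) + ε * |x| ^ (2 - α) * (-γ * (1 + t) ^ (-γ - 1)) := by
    intro t ht
    exact (((hrp β t ht).const_mul (-M)).add
      ((hrp1 (-γ) t ht).const_mul (ε * |x| ^ (2 - α)))).deriv
  have hx1 : ∀ z t : ℝ, 0 < s * z → deriv (fun x' => u x' t) z
      = ε * (s * ((2 - α) * |z| ^ (2 - α - 1))) * (1 + t) ^ (-γ) := by
    intro z t hz
    exact ((((absd_aux s (2 - α) z hs hz).const_mul ε).mul_const ((1 + t) ^ (-γ))).const_add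
      (-M * t ^ β)).deriv
  have Huy : uy = _ := hy1 y hy
  have Huyy : uyy = -M * (β * ((β - 1) * y ^ (β - 1 - 1)))
      + ε * |x| ^ (2 - α) * (-γ * ((-γ - 1) * (1 + y) ^ (-γ - 1 - 1))) := by
    have h := ((((hrp (β - 1) y hy).const_mul β).const_mul (-M)).add
      (((hrp1 (-γ - 1) y hy).const_mul (-γ)).const_mul (ε * |x| ^ (2 - α))))
    refine (h.congr_of_eventuallyEq ?_).deriv
    filter_upwards [hevy] with t ht
    exact hy1 t ht
  have Huxx : uxx = ε * (s * ((2 - α) * (s * ((2 - α - 1) * |x| ^ (2 - α - 1 - 1)))))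
      * (1 + y) ^ (-γ) := by
    have h := (((((absd_aux s (2 - α - 1) x hs hsx).const_mul (2 - α)).const_mul s).const_mul
      ε).mul_const ((1 + y) ^ (-γ)))
    refine (h.congr_of_eventuallyEq ?_).deriv
    filter_upwards [hevx] with t ht
    exact hx1 t y ht
  have Huxy : uxy = ε * (s * ((2 - α) * |x| ^ (2 - α - 1))) * (-γ * (1 + y) ^ (-γ - 1)) := by
    have h := (hrp1 (-γ) y hy).const_mul (ε * (s * ((2 - α) * |x| ^ (2 - α - 1))))
    refine (h.congr_of_eventuallyEq ?_).deriv
    filter_upwards [hevy] with t ht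
    exact hx1 x t hsx
  have hw : 0 < 1 + y := by linarith
  have hs2 : s ^ 2 = 1 := by rcases hs with rfl | rfl <;> norm_num
  have r1 : |x| ^ (2 - α - 1) = |x| ^ (2 - α - 1 - 1) * |x| := by
    rw [Real.rpow_sub_one hX.ne' (2 - α - 1)]; field_simp
  have r2 : |x| ^ (2 - α) = |x| ^ (2 - α - 1 - 1) * |x| ^ 2 := by
    rw [Real.rpow_sub_one hX.ne' (2 - α - 1), Real.rpow_sub_one hX.ne' (2 - α)]; field_simp
  have r3 : (1 + y) ^ (-γ - 1) = (1 + y) ^ (-γ) / (1 + y) := Real.rpow_sub_one hw.ne' _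
  have r4 : (1 + y) ^ (-γ - 1 - 1) = (1 + y) ^ (-γ) / (1 + y) ^ 2 := by
    rw [Real.rpow_sub_one hw.ne', r3]; field_simp
  have r5 : y ^ (β - 1 - 1) = y ^ (β - 1) / y := Real.rpow_sub_one hy.ne' _
  have hA : 0 < |x| ^ (2 - α - 1 - 1) := Real.rpow_pos_of_pos hX _
  have hY : 0 < (1 + y) ^ (-γ) := Real.rpow_pos_of_pos hw _
  have hB : 0 < y ^ (β - 1) := Real.rpow_pos_of_pos hy _
  rw [Huy, Huyy, Huxx, Huxy, r1, r2, r3, r4, r5]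
  generalize |x| ^ (2 - α - 1 - 1) = A at *
  generalize (1 + y) ^ (-γ) = Y at *
  generalize y ^ (β - 1) = B at *
  have main := alg_aux (M * β * B) |x| (ε * A * Y) α β γ y (1 + y) s (by positivity) hX
    (by positivity) hs2 hα0 hα1 hβ1 hγ0 hγα hy rfl
  refine lt_of_lt_of_eq main ?_
  have e1 : ε * (s * ((2 - α) * (s * ((2 - α - 1) * A)))) * Y
      = (2 - α) * (1 - α) * (ε * A * Y) := by
    linear_combination (ε * (2 - α) * (1 - α) * A * Y) * hs2
  rw [e1]
  field_simp
  ring
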